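/- arXiv:1809.07244 — 2 statements merged into one kernel-verified Lean document; each statement's English description precedes it below -/
import Mathlib

section
/- Let r be an integer and let m be a positive integer that is neither 1 nor a prime, and let y be the largest prime factor of m. Then the set of values that probability charges in PR can assign to the residue class r mod m is exactly the closed interval [0, 1/y]: {μ({z ∈ ℤ : z ≡ r (mod m)}) : μ ∈ PR} = [0, 1/y]. -/
/-- A probability charge on ℤ: normalized, nonnegative, finitely additive. -/
def IsProbCharge (μ : Set ℤ → ℝ) : Prop :=
  μ Set.univ = 1 ∧ (∀ A : Set ℤ, 0 ≤ μ A) ∧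
    ∀ A B : Set ℤ, Disjoint A B → μ (A ∪ B) = μ A + μ B

/-- The class of charges giving each residue class mod a prime `p` probability `1/p`. -/
def PR : Set (Set ℤ → ℝ) :=
  {μ | IsProbCharge μ ∧
    ∀ p : ℕ, p.Prime → ∀ j : ℤ, μ {z : ℤ | z ≡ j [ZMOD (p : ℤ)]} = 1 / (p : ℝ)}

/-- The set of (positive) primes, regarded as integers. -/
def IntPrimes : Set ℤ := {z : ℤ | 0 < z ∧ Prime z}

open MeasureTheory Filter Topology

lemma IsProbCharge.mono {μ : Set ℤ → ℝ} (h : IsProbCharge μ) {A B : Set ℤ} (hAB : A ⊆ B) :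
    μ A ≤ μ B := by
  have h1 := h.2.2 A (B \ A) Set.disjoint_sdiff_right
  rw [Set.union_sdiff_cancel hAB] at h1
  linarith [h.2.1 (B \ A)]

lemma convex_PR : Convex ℝ PR := by
  rintro μ ⟨⟨h1, h2, h3⟩, h4⟩ ν ⟨⟨k1, k2, k3⟩, k4⟩ a b ha hb hab
  refine ⟨⟨?_, fun A => ?_, fun A B hAB => ?_⟩, fun p hp j => ?_⟩
  · simp [h1, k1, hab]
  · have := mul_nonneg ha (h2 A)
    have := mul_nonneg hb (k2 A)
    simp only [Pi.add_apply, Pi.smul_apply, smul_eq_mul]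
    linarith
  · simp only [Pi.add_apply, Pi.smul_apply, smul_eq_mul, h3 A B hAB, k3 A B hAB]
    ring
  · simp only [Pi.add_apply, Pi.smul_apply, smul_eq_mul, h4 p hp j, k4 p hp j]
    rw [← add_mul, hab, one_mul]

/-- A limit along a nonprincipal ultrafilter of charges is a charge that takes every value which
is eventually constant along the sequence. -/
lemma exists_isProbCharge_of_seq (ν : ℕ → Set ℤ → ℝ) (hν : ∀ n, IsProbCharge (ν n)) :
    ∃ μ, IsProbCharge μ ∧ ∀ A x, (∀ᶠ n in atTop, ν n A = x) → μ A = x := by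
  have hlim : ∀ A, ∃ x, Tendsto (fun n => ν n A) (hyperfilter ℕ : Filter ℕ) (𝓝 x) := by
    intro A
    obtain ⟨x, -, hx⟩ := (isCompact_Icc (a := (0 : ℝ)) (b := 1)).ultrafilter_le_nhds
      ((hyperfilter ℕ).map fun n => ν n A) (by
        rw [le_principal_iff, Ultrafilter.coe_map, mem_map]
        refine univ_mem' fun n => ⟨(hν n).2.1 A, ?_⟩
        rw [← (hν n).1]
        exact (hν n).mono (Set.subset_univ A))
    exact ⟨x, hx⟩
  choose μ hμ using hlim
  have hconst : ∀ A x, (∀ᶠ n in atTop, ν n A = x) → μ A = x := by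
    intro A x h
    refine tendsto_nhds_unique (hμ A) (Tendsto.congr' ?_ tendsto_const_nhds)
    have hle : (hyperfilter ℕ : Filter ℕ) ≤ atTop := by
      rw [← Nat.cofinite_eq_atTop]
      exact hyperfilter_le_cofinite
    filter_upwards [hle h] with n hn using hn.symm
  refine ⟨μ, ⟨hconst _ _ (Eventually.of_forall fun n => (hν n).1),
    fun A => ge_of_tendsto' (hμ A) fun n => (hν n).2.1 A, fun A B hAB => ?_⟩, hconst⟩
  refine tendsto_nhds_unique (hμ (A ∪ B)) (((hμ A).add (hμ B)).congr fun n => ?_)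
  exact ((hν n).2.2 A B hAB).symm

lemma isProbCharge_preimage {Ω : Type*} [MeasurableSpace Ω] (P : Measure Ω)
    [IsProbabilityMeasure P] {f : Ω → ℤ} (hf : Measurable f) :
    IsProbCharge fun A => P.real (f ⁻¹' A) := by
  refine ⟨by simp, fun A => measureReal_nonneg, fun A B hAB => ?_⟩
  simp only [Set.preimage_union]
  exact measureReal_union (hAB.preimage f) (hf (MeasurableSet.of_discrete))

/-- Coefficients solving simultaneous congruences modulo the `n`-th powers of the primes up to
`n`. -/
lemma exists_crt_coeff (n : ℕ) : ∃ e : ℕ → ℤ, ∀ a : ℕ → ℤ, ∀ p, p.Prime → p ≤ n →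
    ∑ q ∈ Finset.range (n + 1) with q.Prime, e q * a q ≡ a p [ZMOD (p : ℤ) ^ n] := by
  set S := (Finset.range (n + 1)).filter Nat.Prime with hS
  have h : ∀ q : ℕ, ∃ e : ℤ, q.Prime → e ≡ 1 [ZMOD (q : ℤ) ^ n] ∧
      ∀ p ∈ S.erase q, (p : ℤ) ^ n ∣ e := by
    intro q
    by_cases hq : q.Prime
    · have hc : IsCoprime ((q : ℤ) ^ n) (∏ p ∈ S.erase q, (p : ℤ) ^ n) := by
        refine IsCoprime.prod_right fun p hp => IsCoprime.pow ?_
        rw [Nat.isCoprime_iff_coprime]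
        have hp' := Finset.mem_erase.1 hp
        exact (Nat.coprime_primes hq (Finset.mem_filter.1 hp'.2).2).2 hp'.1.symm
      obtain ⟨a, b, hab⟩ := hc
      refine ⟨b * ∏ p ∈ S.erase q, (p : ℤ) ^ n, fun _ => ⟨?_, fun p hp => ?_⟩⟩
      · rw [Int.modEq_iff_dvd]
        exact ⟨a, by linear_combination hab.symm⟩
      · exact Dvd.dvd.mul_left (Finset.dvd_prod_of_mem _ hp) b
    · exact ⟨0, fun h => absurd h hq⟩
  choose e he using h
  refine ⟨e, fun a p hp hpn => ?_⟩
  have hpS : p ∈ S := by simp [hS, hp]; omega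
  rw [← Finset.add_sum_erase S _ hpS]
  have h1 : e p * a p ≡ 1 * a p [ZMOD (p : ℤ) ^ n] := (he p hp).1.mul_right _
  have h2 : ∑ q ∈ S.erase p, e q * a q ≡ 0 [ZMOD (p : ℤ) ^ n] := by
    rw [Int.modEq_zero_iff_dvd]
    refine Finset.dvd_sum fun q hq => Dvd.dvd.mul_right ?_ _
    have hq' := Finset.mem_erase.1 hq
    exact (he q (Finset.mem_filter.1 hq'.2).2).2 p (Finset.mem_erase.2 ⟨hq'.1.symm, hpS⟩)
  simpa using h1.add h2

lemma Int.add_units_mul_modEq_iff (c j k n : ℤ) (s : ℤˣ) :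
    c + s * k ≡ j [ZMOD n] ↔ k ≡ s * (j - c) [ZMOD n] := by
  rcases Int.units_eq_one_or s with rfl | rfl <;>
    simp only [Int.modEq_iff_dvd, Units.val_one, Units.val_neg]
  · ring_nf
  · rw [← dvd_neg]; ring_nf

lemma volume_real_floor_modEq {p : ℕ} (hp : 0 < p) (c j : ℤ) (s : ℤˣ) :
    (volume.restrict (Set.Ico (0 : ℝ) 1)).real
      {u | c + s * ⌊(p : ℝ) * u⌋ ≡ j [ZMOD p]} = 1 / p := by
  have hpR : (0 : ℝ) < p := by exact_mod_cast hp
  have hpZ : (0 : ℤ) < p := by exact_mod_cast hp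
  set i : ℤ := s * (j - c) % p with hi
  have hi0 : 0 ≤ i := Int.emod_nonneg _ hpZ.ne'
  have hip : i < p := Int.emod_lt_of_pos _ hpZ
  have hi0R : (0 : ℝ) ≤ i := by exact_mod_cast hi0
  have hipR : (i : ℝ) + 1 ≤ p := by exact_mod_cast hip
  rw [measureReal_restrict_apply' measurableSet_Ico]
  have : {u : ℝ | c + s * ⌊(p : ℝ) * u⌋ ≡ j [ZMOD p]} ∩ Set.Ico 0 1 =
      Set.Ico ((i : ℝ) / p) ((i + 1) / p) := by
    ext u
    simp only [Set.mem_inter_iff, Set.mem_ofPred_eq, Set.mem_Ico, Int.add_units_mul_modEq_iff,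
      div_le_iff₀ hpR, lt_div_iff₀ hpR]
    constructor
    · rintro ⟨h, h0, h1⟩
      have hk : ⌊(p : ℝ) * u⌋ = i := by
        rw [hi, ← h, Int.emod_eq_of_lt]
        · positivity
        · rw [Int.floor_lt]; push_cast; nlinarith
      rw [Int.floor_eq_iff] at hk
      constructor <;> linarith
    · rintro ⟨h0, h1⟩
      have hk : ⌊(p : ℝ) * u⌋ = i := by
        rw [Int.floor_eq_iff]; constructor <;> linarith
      refine ⟨?_, by nlinarith, by nlinarith⟩
      rw [hk]
      exact Int.mod_modEq _ _
  rw [this, Real.volume_real_Ico_of_le (by gcongr; linarith)]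
  ring

/-- A charge in `PR` whose residues modulo powers of each prime `p` are distributed as
`c p ± ⌊p u⌋` with one common uniform `u ∈ [0, 1)`. -/
lemma exists_mem_PR (c : ℕ → ℤ) (s : ℕ → ℤˣ) (r : ℤ) {m : ℕ} (hm : 0 < m) :
    ∃ μ ∈ PR, μ {z : ℤ | z ≡ r [ZMOD (m : ℤ)]} = (volume.restrict (Set.Ico (0 : ℝ) 1)).real
      {u | ∀ p k : ℕ, p.Prime → p ^ k ∣ m →
        c p + s p * ⌊(p : ℝ) * u⌋ ≡ r [ZMOD (p : ℤ) ^ k]} := by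
  choose e he using exists_crt_coeff
  let a : ℝ → ℕ → ℤ := fun u p => c p + s p * ⌊(p : ℝ) * u⌋
  let f : ℕ → ℝ → ℤ := fun n u => ∑ q ∈ Finset.range (n + 1) with q.Prime, e n q * a u q
  have hf : ∀ n, Measurable (f n) := by
    intro n
    refine Finset.measurable_sum _ fun q _ => ?_
    have : Measurable fun u : ℝ => ⌊(q : ℝ) * u⌋ := (measurable_id.const_mul _).floor
    exact ((this.const_mul _).const_add _).const_mul _
  have hfa : ∀ (n : ℕ) u (p : ℕ), p.Prime → p ≤ n → f n u ≡ a u p [ZMOD (p : ℤ) ^ n] :=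
    fun n u p hp hpn => he n (a u) p hp hpn
  have : IsProbabilityMeasure (volume.restrict (Set.Ico (0 : ℝ) 1)) := ⟨by simp⟩
  obtain ⟨μ, hμ, hconst⟩ := exists_isProbCharge_of_seq _ fun n =>
    isProbCharge_preimage (volume.restrict (Set.Ico (0 : ℝ) 1)) (hf n)
  refine ⟨μ, ⟨hμ, fun p hp j => hconst _ _ ?_⟩, hconst _ _ ?_⟩
  · filter_upwards [eventually_ge_atTop p] with n hn
    rw [← volume_real_floor_modEq hp.pos (c p) j (s p)]
    congr 1
    ext u
    have h : f n u ≡ a u p [ZMOD p] :=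
      (hfa n u p hp hn).of_dvd (dvd_pow_self _ (hp.pos.trans_le hn).ne')
    exact ⟨h.symm.trans, h.trans⟩
  · filter_upwards [eventually_ge_atTop m] with n hn
    congr 1
    ext u
    have hdvd : f n u ≡ r [ZMOD m] ↔
        ∀ p k : ℕ, p.Prime → p ^ k ∣ m → f n u ≡ r [ZMOD (p : ℤ) ^ k] := by
      simp only [Int.modEq_iff_dvd, ← Int.natCast_pow, Int.natCast_dvd]
      exact Nat.dvd_iff_prime_pow_dvd_dvd _ _
    change f n u ≡ r [ZMOD m] ↔ ∀ p k : ℕ, p.Prime → p ^ k ∣ m → a u p ≡ r [ZMOD (p : ℤ) ^ k]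
    rw [hdvd]
    refine forall₄_congr fun p k hp hpk => ?_
    rcases Nat.eq_zero_or_pos k with rfl | hk
    · simp [Int.modEq_one]
    have hle : p ^ k ≤ m := Nat.le_of_dvd hm hpk
    have hkn : k ≤ n := ((Nat.lt_pow_self hp.one_lt).le.trans hle).trans hn
    have hpn : p ≤ n := ((Nat.le_self_pow hk.ne' p).trans hle).trans hn
    have h : f n u ≡ a u p [ZMOD (p : ℤ) ^ k] := (hfa n u p hp hpn).of_dvd (pow_dvd_pow _ hkn)
    exact ⟨h.symm.trans, h.trans⟩

lemma floor_mul_mem_Ico {p : ℕ} (hp : 0 < p) {u : ℝ} (hu : u ∈ Set.Ico (0 : ℝ) 1) :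
    ⌊(p : ℝ) * u⌋ ∈ Set.Ico (0 : ℤ) p := by
  have hpR : (0 : ℝ) < p := by exact_mod_cast hp
  refine ⟨Int.floor_nonneg.2 (mul_nonneg hpR.le hu.1), ?_⟩
  rw [Int.floor_lt]
  push_cast
  nlinarith [hu.2]

lemma exists_mem_PR_eq_one_div (r : ℤ) {m y : ℕ} (hm : 0 < m) (hy : y.Prime) (hym : y ∣ m)
    (hymax : ∀ q : ℕ, q.Prime → q ∣ m → q ≤ y) :
    ∃ μ ∈ PR, μ {z : ℤ | z ≡ r [ZMOD (m : ℤ)]} = 1 / (y : ℝ) := by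
  obtain ⟨μ, hμ, h⟩ := exists_mem_PR (fun _ => r) (fun _ => 1) r hm
  refine ⟨μ, hμ, h.trans ?_⟩
  rw [← volume_real_floor_modEq hy.pos r r 1, measureReal_restrict_apply' measurableSet_Ico,
    measureReal_restrict_apply' measurableSet_Ico]
  congr 1
  ext u
  simp only [Set.mem_inter_iff, Set.mem_ofPred_eq, and_congr_left_iff]
  intro hu
  constructor
  · intro h
    simpa using h y 1 hy (by simpa using hym)
  · intro h p k hp hpk
    rcases Nat.eq_zero_or_pos k with rfl | hk
    · simp
    have hpy : p ≤ y := hymax p hp ((dvd_pow_self p hk.ne').trans hpk)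
    have hy0 := floor_mul_mem_Ico hy.pos hu
    have hp0 := floor_mul_mem_Ico hp.pos hu
    have hle : ⌊(p : ℝ) * u⌋ ≤ ⌊(y : ℝ) * u⌋ :=
      Int.floor_le_floor (mul_le_mul_of_nonneg_right (by exact_mod_cast hpy) hu.1)
    have hz : ⌊(y : ℝ) * u⌋ = 0 := by
      rw [Int.add_units_mul_modEq_iff, sub_self, mul_zero, Int.modEq_zero_iff_dvd] at h
      exact Int.eq_zero_of_dvd_of_nonneg_of_lt hy0.1 hy0.2 h
    have : ⌊(p : ℝ) * u⌋ = 0 := le_antisymm (hle.trans hz.le) hp0.1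
    simp [this]

lemma exists_mem_PR_eq_zero_of_sq_dvd (r : ℤ) {m p : ℕ} (hm : 0 < m) (hp : p.Prime)
    (hpm : p ^ 2 ∣ m) : ∃ μ ∈ PR, μ {z : ℤ | z ≡ r [ZMOD (m : ℤ)]} = 0 := by
  obtain ⟨μ, hμ, h⟩ := exists_mem_PR (fun _ => r + p) (fun _ => 1) r hm
  refine ⟨μ, hμ, h.trans ?_⟩
  rw [measureReal_restrict_apply' measurableSet_Ico]
  convert measureReal_empty
  refine Set.eq_empty_of_forall_notMem ?_
  rintro u ⟨hmem, hu⟩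
  have h1 := (hmem p 2 hp hpm).symm.dvd
  have h2 := floor_mul_mem_Ico hp.pos hu
  have hp2 : (2 : ℤ) ≤ p := by exact_mod_cast hp.two_le
  have h3 : (p : ℤ) ^ 2 ∣ ⌊(p : ℝ) * u⌋ + p := by
    convert h1 using 1
    simp only [Units.val_one]
    ring
  have := Int.le_of_dvd (by linarith [h2.1]) h3
  nlinarith [h2.2]

lemma exists_mem_PR_eq_zero_of_ne (r : ℤ) {m p q : ℕ} (hm : 0 < m) (hp : p.Prime) (hq : q.Prime)
    (hpq : p ≠ q) (hpm : p ∣ m) (hqm : q ∣ m) :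
    ∃ μ ∈ PR, μ {z : ℤ | z ≡ r [ZMOD (m : ℤ)]} = 0 := by
  obtain ⟨μ, hμ, h⟩ := exists_mem_PR (fun l => if l = p then r - 1 else r)
    (fun l => if l = p then -1 else 1) r hm
  refine ⟨μ, hμ, h.trans ?_⟩
  rw [measureReal_restrict_apply' measurableSet_Ico]
  convert measureReal_empty
  refine Set.eq_empty_of_forall_notMem ?_
  rintro u ⟨hmem, hu⟩
  have hp1 := hmem p 1 hp (by simpa using hpm)
  have hq1 := hmem q 1 hq (by simpa using hqm)
  simp only [if_pos, if_neg hpq.symm, Int.add_units_mul_modEq_iff, pow_one, sub_self,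
    mul_zero, Int.modEq_zero_iff_dvd] at hp1 hq1
  have hpI := floor_mul_mem_Ico hp.pos hu
  have hqI := floor_mul_mem_Ico hq.pos hu
  have hq0 : ⌊(q : ℝ) * u⌋ = 0 := Int.eq_zero_of_dvd_of_nonneg_of_lt hqI.1 hqI.2 hq1
  have hp0 : (p : ℤ) ≤ ⌊(p : ℝ) * u⌋ + 1 := by
    refine Int.le_of_dvd (by linarith [hpI.1]) ?_
    have := hp1.symm.dvd
    simpa using this
  have hp0R : (p : ℝ) ≤ ⌊(p : ℝ) * u⌋ + 1 := by exact_mod_cast hp0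
  have hpu := Int.floor_le ((p : ℝ) * u)
  have hqu := (Int.floor_eq_zero_iff.1 hq0).2
  have hp2 : (2 : ℝ) ≤ p := by exact_mod_cast hp.two_le
  have hq2 : (2 : ℝ) ≤ q := by exact_mod_cast hq.two_le
  have hu2 : u < 1 / 2 := by nlinarith [hu.1]
  nlinarith

lemma exists_mem_PR_eq_zero (r : ℤ) {m : ℕ} (hm : 0 < m) (hm1 : m ≠ 1) (hmp : ¬ m.Prime) :
    ∃ μ ∈ PR, μ {z : ℤ | z ≡ r [ZMOD (m : ℤ)]} = 0 := by
  obtain ⟨p, hp, d, rfl⟩ := Nat.exists_prime_and_dvd hm1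
  have hd : d ≠ 1 := by
    rintro rfl
    exact hmp (by simpa using hp)
  obtain ⟨q, hq, hqd⟩ := Nat.exists_prime_and_dvd hd
  by_cases hpq : p = q
  · subst hpq
    exact exists_mem_PR_eq_zero_of_sq_dvd r hm hp (by rw [sq]; exact Nat.mul_dvd_mul_left p hqd)
  · exact exists_mem_PR_eq_zero_of_ne r hm hp hq hpq (Dvd.intro d rfl) (hqd.mul_left p)

theorem stmt3 (r : ℤ) (m : ℕ) (hm : 0 < m) (hm1 : m ≠ 1) (hmp : ¬ m.Prime)
    (y : ℕ) (hy : y.Prime) (hym : y ∣ m)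
    (hymax : ∀ q : ℕ, q.Prime → q ∣ m → q ≤ y) :
    {x : ℝ | ∃ μ ∈ PR, μ {z : ℤ | z ≡ r [ZMOD (m : ℤ)]} = x} =
      Set.Icc 0 (1 / (y : ℝ)) := by
  ext x
  constructor
  · rintro ⟨μ, ⟨hμ, hμp⟩, rfl⟩
    refine ⟨hμ.2.1 _, ?_⟩
    rw [← hμp y hy r]
    exact hμ.mono fun z hz => Int.ModEq.of_dvd (Int.natCast_dvd_natCast.2 hym) hz
  · rintro ⟨hx0, hx1⟩
    obtain ⟨μ, hμ, hμ0⟩ := exists_mem_PR_eq_zero r hm hm1 hmp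
    obtain ⟨ν, hν, hν1⟩ := exists_mem_PR_eq_one_div r hm hy hym hymax
    have hyR : (0 : ℝ) < y := by exact_mod_cast hy.pos
    have hxy : x * y ≤ 1 := (le_div_iff₀ hyR).1 hx1
    refine ⟨_, convex_PR hμ hν (sub_nonneg.2 hxy) (mul_nonneg hx0 hyR.le) (by ring), ?_⟩
    simp only [Pi.add_apply, Pi.smul_apply, smul_eq_mul, hμ0, hν1]
    field_simp
    ring
end

section
/- For every S ⊆ ℤ, sSup {μ(S) : μ ∈ PR} ≥ limsup_{N→∞} (max_𝒥 card(𝒥 ∩ Alive_N(S)) / P_N), where for each N the maximum is over all multisets 𝒥 of tuples j ∈ ∏_{n=1}^N {0, 1, …, p_n − 1} with the property that for every n ≤ N the multiset of n-th coordinates of 𝒥 contains each element of {0, 1, …, p_n − 1} with multiplicity exactly P_N / p_n; Alive_N(S) denotes the set of tuples j ∈ ∏_{n=1}^N {0, 1, …, p_n − 1} such that there exists z ∈ S with z ≡ j_n (mod p_n) for all n ≤ N; and card(𝒥 ∩ Alive_N(S)) counts, with multiplicity, the elements of 𝒥 lying in Alive_N(S). -/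
/-- `nthPrime n` is the `(n+1)`-st prime: `nthPrime 0 = 2`, `nthPrime 1 = 3`, … -/
noncomputable def nthPrime (n : ℕ) : ℕ := Nat.nth Nat.Prime n

theorem nthPrime_prime (n : ℕ) : (nthPrime n).Prime :=
  Nat.nth_mem_of_infinite Nat.infinite_setOfPred_prime n

theorem nthPrime_injective : Function.Injective nthPrime :=
  Nat.nth_injective Nat.infinite_setOfPred_prime

theorem exists_nthPrime_eq {p : ℕ} (hp : p.Prime) : ∃ n, nthPrime n = p :=
  ⟨_, Nat.nth_count hp⟩

/-- Chinese remainder theorem for the first `N` primes. -/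
theorem exists_int_modEq_nthPrime {N : ℕ} (v : (n : Fin N) → Fin (nthPrime n)) :
    ∃ z : ℤ, ∀ n : Fin N, z ≡ ((v n : ℕ) : ℤ) [ZMOD (nthPrime n : ℤ)] := by
  obtain ⟨k, hk⟩ := Nat.chineseRemainderOfFinset (fun n : Fin N => (v n : ℕ))
    (fun n : Fin N => nthPrime n) Finset.univ (fun n _ => (nthPrime_prime n).ne_zero)
    (fun a _ b _ hab => (Nat.coprime_primes (nthPrime_prime a) (nthPrime_prime b)).2
      fun h => hab (Fin.ext (nthPrime_injective h)))
  exact ⟨k, fun n => Int.natCast_modEq_iff.2 (hk n (Finset.mem_univ n))⟩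

theorem IsProbCharge.le_one {μ : Set ℤ → ℝ} (h : IsProbCharge μ) (A : Set ℤ) : μ A ≤ 1 := by
  have := h.2.2 A Aᶜ disjoint_compl_right
  rw [Set.union_compl_self, h.1] at this
  linarith [h.2.1 Aᶜ]

open scoped Classical in
/-- The uniform distribution on a nonempty multiset of integers is a probability charge. -/
theorem isProbCharge_countP_div (M : Multiset ℤ) (hM : M.card ≠ 0) :
    IsProbCharge fun A => (M.countP (· ∈ A) : ℝ) / M.card := by
  refine ⟨?_, fun A => by positivity, fun A B hAB => ?_⟩
  · simp [hM]
  · suffices h : M.countP (· ∈ A ∪ B) = M.countP (· ∈ A) + M.countP (· ∈ B) by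
      beta_reduce
      rw [← add_div, ← Nat.cast_add, ← h]
      congr!
    clear hM
    induction M using Multiset.induction_on with
    | empty => simp
    | cons a M ih =>
      have hab : a ∈ A → a ∉ B := fun ha hb => Set.disjoint_left.1 hAB ha hb
      simp only [Multiset.countP_cons, Set.mem_union] at ih ⊢
      rw [ih]
      by_cases ha : a ∈ A <;> by_cases hb : a ∈ B <;> simp_all <;> lia

open scoped Classical in
/-- A balanced multiset of residue tuples is realised by a charge with the right residue
probabilities for the first `N` primes. -/
theorem exists_isProbCharge_of_balanced (S : Set ℤ) {N : ℕ} (hN : 0 < N)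
    (J : Multiset ((n : Fin N) → Fin (nthPrime n)))
    (hJ : ∀ n : Fin N, ∀ k : Fin (nthPrime n),
      (J.map fun v => v n).count k = (∏ t : Fin N, nthPrime t) / nthPrime n) :
    ∃ μ : Set ℤ → ℝ, IsProbCharge μ ∧
      (∀ n < N, ∀ j : ℤ, μ {z : ℤ | z ≡ j [ZMOD (nthPrime n : ℤ)]} = 1 / (nthPrime n : ℝ)) ∧
      ((J.filter fun v => ∃ z ∈ S, ∀ n : Fin N,
        z ≡ ((v n : ℕ) : ℤ) [ZMOD (nthPrime n : ℤ)]).card : ℝ) /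
          ((∏ t : Fin N, nthPrime t) : ℝ) ≤ μ S := by
  have hdvd : ∀ n : Fin N, nthPrime n ∣ ∏ t : Fin N, nthPrime t := fun n =>
    Finset.dvd_prod_of_mem (fun t : Fin N => nthPrime t) (Finset.mem_univ n)
  have hP : (∏ t : Fin N, nthPrime t) ≠ 0 :=
    Finset.prod_ne_zero_iff.2 fun t _ => (nthPrime_prime t).ne_zero
  have hcard : J.card = ∏ t : Fin N, nthPrime t := by
    have h := Multiset.sum_count_eq_card (s := Finset.univ)
      (m := J.map fun v => v ⟨0, hN⟩) (fun _ _ => Finset.mem_univ _)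
    simp only [hJ, Finset.sum_const, Finset.card_univ, Fintype.card_fin, smul_eq_mul,
      Multiset.card_map] at h
    rw [← h]
    exact Nat.mul_div_cancel' (hdvd ⟨0, hN⟩)
  have hrep : ∀ v : (n : Fin N) → Fin (nthPrime n), ∃ z : ℤ,
      (∀ n : Fin N, z ≡ ((v n : ℕ) : ℤ) [ZMOD (nthPrime n : ℤ)]) ∧
      ((∃ z ∈ S, ∀ n : Fin N, z ≡ ((v n : ℕ) : ℤ) [ZMOD (nthPrime n : ℤ)]) → z ∈ S) := by
    intro v
    by_cases h : ∃ z ∈ S, ∀ n : Fin N, z ≡ ((v n : ℕ) : ℤ) [ZMOD (nthPrime n : ℤ)]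
    · obtain ⟨z, hz, hzv⟩ := h
      exact ⟨z, hzv, fun _ => hz⟩
    · obtain ⟨z, hz⟩ := exists_int_modEq_nthPrime v
      exact ⟨z, hz, fun h' => absurd h' h⟩
  choose f hf hfS using hrep
  have hMcard : (J.map f).card = ∏ t : Fin N, nthPrime t := by rw [Multiset.card_map, hcard]
  refine ⟨_, isProbCharge_countP_div (J.map f) (hMcard ▸ hP), fun n hn j => ?_, ?_⟩
  · have hp := nthPrime_prime n
    have hp0 : (nthPrime n : ℤ) ≠ 0 := by exact_mod_cast hp.ne_zero
    have hj0 := Int.emod_nonneg j hp0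
    have hjlt := Int.emod_lt_of_pos j (b := nthPrime n) (by exact_mod_cast hp.pos)
    have hcount : (J.map f).countP (· ∈ {z : ℤ | z ≡ j [ZMOD (nthPrime n : ℤ)]}) =
        (∏ t : Fin N, nthPrime t) / nthPrime n := by
      rw [← hJ ⟨n, hn⟩ ⟨(j % nthPrime n).toNat, by lia⟩, Multiset.count_map,
        Multiset.countP_map]
      congr 1
      refine Multiset.filter_congr fun v _ => ?_
      have hv := hf v ⟨n, hn⟩
      have hlt : ((v ⟨n, hn⟩ : ℕ) : ℤ) < nthPrime n := by exact_mod_cast (v ⟨n, hn⟩).2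
      have hvmod := Int.emod_eq_of_lt (by positivity) hlt
      simp only [Int.ModEq] at hv
      simp only [Set.mem_ofPred_eq, Int.ModEq, Fin.ext_iff]
      rw [hv, hvmod]
      lia
    have hp' : (nthPrime n : ℝ) ≠ 0 := by exact_mod_cast hp.ne_zero
    have hP' : ((∏ t : Fin N, nthPrime t : ℕ) : ℝ) ≠ 0 := by exact_mod_cast hP
    calc _ = (((∏ t : Fin N, nthPrime t) / nthPrime n : ℕ) : ℝ) /
          ((∏ t : Fin N, nthPrime t : ℕ) : ℝ) := by
          rw [hMcard]
          congr 2
          convert hcount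
      _ = _ := by
          rw [Nat.cast_div (hdvd ⟨n, hn⟩) hp']
          field_simp
  · rw [hMcard, Nat.cast_prod]
    gcongr
    rw [Multiset.countP_map]
    exact Multiset.card_le_card (Multiset.monotone_filter_right J fun v hv => hfS v hv)

/-- Pointwise limits of probability charges along an ultrafilter. -/
theorem exists_isProbCharge_tendsto {ι : Type*} (U : Ultrafilter ι) (μ : ι → Set ℤ → ℝ)
    (hμ : ∀ᶠ i in U, IsProbCharge (μ i)) :
    ∃ ν : Set ℤ → ℝ, IsProbCharge ν ∧
      ∀ A, Filter.Tendsto (fun i => μ i A) U (nhds (ν A)) := by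
  have hlim : ∀ A, ∃ x : ℝ, Filter.Tendsto (fun i => μ i A) U (nhds x) := by
    intro A
    obtain ⟨x, -, hx⟩ := (isCompact_Icc (a := (0 : ℝ)) (b := 1)).ultrafilter_le_nhds
      (U.map fun i => μ i A) (Filter.le_principal_iff.2
        (hμ.mono fun i hi => ⟨hi.2.1 A, hi.le_one A⟩ :
          ∀ᶠ i in (U : Filter ι), μ i A ∈ Set.Icc (0 : ℝ) 1))
    exact ⟨x, hx⟩
  choose ν hν using hlim
  refine ⟨ν, ⟨?_, fun A => ?_, fun A B hAB => ?_⟩, hν⟩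
  · refine tendsto_nhds_unique (hν Set.univ) (tendsto_const_nhds.congr' ?_)
    filter_upwards [hμ] with i hi using hi.1.symm
  · exact ge_of_tendsto (hν A) (hμ.mono fun i hi => hi.2.1 A)
  · refine tendsto_nhds_unique (hν (A ∪ B)) (((hν A).add (hν B)).congr' ?_)
    filter_upwards [hμ] with i hi using (hi.2.2 A B hAB).symm

/-- If charges that are correct on the first `N` primes give `S` mass above `c` for arbitrarily
large `N`, then some charge in `PR` gives `S` mass at least `c`. -/
theorem exists_mem_PR_le {S : Set ℤ} {c : ℝ}
    (h : ∃ᶠ N in Filter.atTop, ∃ μ : Set ℤ → ℝ, IsProbCharge μ ∧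
      (∀ n < N, ∀ j : ℤ, μ {z : ℤ | z ≡ j [ZMOD (nthPrime n : ℤ)]} = 1 / (nthPrime n : ℝ)) ∧
      c ≤ μ S) :
    ∃ μ ∈ PR, c ≤ μ S := by
  obtain ⟨U, hU⟩ := Filter.exists_ultrafilter_iff.2 (Filter.frequently_iff_neBot.1 h)
  have hgood := Filter.le_principal_iff.1 (hU.trans inf_le_right)
  replace hU := hU.trans inf_le_left
  choose! μ hμ using fun N (hN : ∃ μ : Set ℤ → ℝ, IsProbCharge μ ∧
      (∀ n < N, ∀ j : ℤ, μ {z : ℤ | z ≡ j [ZMOD (nthPrime n : ℤ)]} = 1 / (nthPrime n : ℝ)) ∧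
      c ≤ μ S) => hN
  replace hgood : ∀ᶠ N in (U : Filter ℕ), _ := Filter.mem_of_superset hgood hμ
  obtain ⟨ν, hν, hlim⟩ := exists_isProbCharge_tendsto U μ (hgood.mono fun _ h => h.1)
  refine ⟨ν, ⟨hν, fun p hp j => ?_⟩, ge_of_tendsto (hlim S) (hgood.mono fun _ h => h.2.2)⟩
  obtain ⟨n, rfl⟩ := exists_nthPrime_eq hp
  refine tendsto_nhds_unique (hlim _) (tendsto_const_nhds.congr' ?_)
  filter_upwards [hgood, hU (Filter.eventually_gt_atTop n)] with N hN hnN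
    using (hN.2.1 n hnN j).symm

open scoped Classical in
theorem stmt7 (S : Set ℤ) :
    sSup {x : ℝ | ∃ μ ∈ PR, μ S = x} ≥
      Filter.limsup (fun N : ℕ =>
        sSup {x : ℝ | ∃ 𝒥 : Multiset ((n : Fin N) → Fin (nthPrime n)),
          (∀ n : Fin N, ∀ k : Fin (nthPrime n),
            (𝒥.map fun v => v n).count k =
              (∏ t : Fin N, nthPrime t) / nthPrime n) ∧
          x = ((𝒥.filter fun v => ∃ z ∈ S, ∀ n : Fin N,
                z ≡ ((v n : ℕ) : ℤ) [ZMOD (nthPrime n : ℤ)]).card : ℝ) /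
              ((∏ t : Fin N, nthPrime t) : ℝ)}) Filter.atTop := by
  have hnonneg : 0 ≤ sSup {x : ℝ | ∃ μ ∈ PR, μ S = x} :=
    Real.sSup_nonneg fun x ⟨μ, hμ, hx⟩ => hx ▸ hμ.1.2.1 S
  refine le_of_forall_lt fun c hc => ?_
  obtain ⟨d, hcd, hd⟩ := exists_between hc
  refine hcd.trans_le ?_
  rcases lt_or_ge d 0 with hd0 | hd0
  · exact hd0.le.trans hnonneg
  have hfreq := Filter.frequently_lt_of_lt_limsup (Filter.IsBoundedUnder.isCoboundedUnder_le
    (Filter.isBoundedUnder_of ⟨0, fun N => Real.sSup_nonneg (by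
      rintro x ⟨J, -, rfl⟩
      positivity)⟩)) hd
  obtain ⟨μ, hμ, hμS⟩ : ∃ μ ∈ PR, d ≤ μ S := by
    refine exists_mem_PR_le
      ((hfreq.and_eventually (Filter.eventually_gt_atTop 0)).mono fun N ⟨hdN, hN⟩ => ?_)
    obtain ⟨x, ⟨J, hJ, rfl⟩, hdx⟩ := exists_lt_of_lt_csSup
      (Set.nonempty_iff_ne_empty.2 fun h => by
        rw [h, Real.sSup_empty] at hdN
        exact hd0.not_gt hdN) hdN
    obtain ⟨μ, hμ, hres, hS⟩ := exists_isProbCharge_of_balanced S hN J hJ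
    exact ⟨μ, hμ, hres, hdx.le.trans hS⟩
  exact hμS.trans (le_csSup ⟨1, fun x ⟨ν, hν, hx⟩ => hx ▸ hν.1.le_one S⟩ ⟨μ, hμ, rfl⟩)
end
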